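/- For n ≥ 2, log₂ n − 1 ≤ τ_n ≤ log₂ n, where τ_n = lim_{a→∞} (1/a)·log₂ max{T_n(R) : R a region of area an}; in particular τ_n ≥ log₂⌈n/2⌉ ≥ log₂ n − 1. -/

import Mathlib

attribute [local instance] Classical.propDecidable

/-- The level of the unit square `[x,x+1] × [y,y+1]`, indexed by `(x,y)`. -/
def level (s : ℤ × ℤ) : ℤ := s.1 + s.2

/-- An `n`-ribbon: a connected sequence of `n` unit squares, each after the first
directly above or to the right of its predecessor. -/
def IsRibbon (n : ℕ) (T : Finset (ℤ × ℤ)) : Prop :=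
  ∃ f : ℕ → ℤ × ℤ,
    (∀ i, i + 1 < n → f (i + 1) = f i + (1, 0) ∨ f (i + 1) = f i + (0, 1)) ∧
    T = (Finset.range n).image f

/-- An `n`-ribbon tiling of a region `R`: a partition of the squares of `R` into `n`-ribbons. -/
def IsTiling (n : ℕ) (R : Finset (ℤ × ℤ)) (P : Finset (Finset (ℤ × ℤ))) : Prop :=
  (∀ T ∈ P, IsRibbon n T) ∧
  (P : Set (Finset (ℤ × ℤ))).PairwiseDisjoint id ∧
  P.biUnion id = R

/-- The number of `n`-ribbon tilings of a region `R`. -/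
noncomputable def TilingCount (n : ℕ) (R : Finset (ℤ × ℤ)) : ℕ :=
  Set.ncard {P | IsTiling n R P}

/-- `s` is the root square of the tile `T`: its square of smallest level. -/
def IsRoot (T : Finset (ℤ × ℤ)) (s : ℤ × ℤ) : Prop :=
  s ∈ T ∧ ∀ t ∈ T, level s ≤ level t

/-- The set of root squares of the tiles of a tiling `P`. -/
def rootSet (P : Finset (Finset (ℤ × ℤ))) : Set (ℤ × ℤ) :=
  {s | ∃ T ∈ P, IsRoot T s}

/-- The number `τ_l` of tiles of `P` whose root square has level `l`. -/
noncomputable def tilesAtLevel (P : Finset (Finset (ℤ × ℤ))) (l : ℤ) : ℕ :=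
  (P.filter (fun T => ∃ s, IsRoot T s ∧ level s = l)).card

/-- The left-of relation on unit squares. -/
def LeftOf (s t : ℤ × ℤ) : Prop :=
  (level s = level t ∧ s.1 < t.1) ∨ (|level s - level t| = 1 ∧ s.1 ≤ t.1 ∧ t.2 ≤ s.2)

/-- The maximal number of `n`-ribbon tilings over all regions of area `a * n`. -/
noncomputable def maxT (n a : ℕ) : ℕ :=
  sSup {t : ℕ | ∃ R : Finset (ℤ × ℤ), R.card = a * n ∧ TilingCount n R = t}

/-- AM-GM over `ℕ`: numbers of given total have product at most the power of their mean. -/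
theorem prod_le_pow_of_sum_le {β : Type*} (Z : Finset β) (f : β → ℕ) (n : ℕ)
    (h : ∑ z ∈ Z, f z ≤ Z.card * n) : ∏ z ∈ Z, f z ≤ n ^ Z.card := by
  rcases Z.eq_empty_or_nonempty with rfl | hZ
  · simp
  have hc : (0 : ℝ) < Z.card := by exact_mod_cast hZ.card_pos
  have key := Real.geom_mean_le_arith_mean Z (fun _ => (1 : ℝ)) (fun z => (f z : ℝ))
    (by simp) (by simpa using hc) (by simp)
  simp only [Real.rpow_one, Finset.sum_const, nsmul_eq_mul, mul_one, one_mul] at key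
  have hle : (∑ z ∈ Z, (f z : ℝ)) / Z.card ≤ n := by
    rw [div_le_iff₀ hc]
    calc (∑ z ∈ Z, (f z : ℝ)) = ((∑ z ∈ Z, f z : ℕ) : ℝ) := by push_cast; rfl
      _ ≤ ((Z.card * n : ℕ) : ℝ) := by exact_mod_cast h
      _ = n * Z.card := by push_cast; ring
  have hp : (0 : ℝ) ≤ ∏ z ∈ Z, (f z : ℝ) := Finset.prod_nonneg (by simp)
  have := pow_le_pow_left₀ (by positivity) (key.trans hle) Z.card
  rw [Real.rpow_inv_natCast_pow hp (by exact_mod_cast hc.ne')] at this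
  exact_mod_cast this

/-- A Kraft-type inequality: if any two objects are separated by a prescribed value of a choice
function on the cells `V i`, then there are at most `n ^ a` objects, `n` being a bound for the
mean size of the `a` cells used by each object. -/
theorem card_le_pow_of_separated {ι α β : Type*} [Fintype ι] (V : ι → Finset β)
    (hV : ∀ i, (V i).Nonempty) (A : Finset α) (Z : α → Finset β) (b : α → β → ι) (n a : ℕ)
    (hinj : ∀ P ∈ A, Set.InjOn (b P) (Z P)) (hmem : ∀ P ∈ A, ∀ z ∈ Z P, z ∈ V (b P z))
    (hcard : ∀ P ∈ A, (Z P).card = a) (hsum : ∀ P ∈ A, ∑ z ∈ Z P, (V (b P z)).card ≤ a * n)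
    (hsep : ∀ P ∈ A, ∀ P' ∈ A, P ≠ P' → ∃ z ∈ Z P, ∃ z' ∈ Z P', b P z = b P' z' ∧ z ≠ z') :
    A.card ≤ n ^ a := by
  set U : α → ι → Finset β := fun P i => (V i).filter (fun v => ∀ z ∈ Z P, b P z = i → v = z)
    with hU
  have hbound : ∀ P ∈ A, (Fintype.piFinset V).card ≤ (Fintype.piFinset (U P)).card * n ^ a := by
    intro P hP
    have h1 : ∀ i, (V i).card ≤
        (U P i).card * (if i ∈ (Z P).image (b P) then (V i).card else 1) := by
      intro i
      split_ifs with hi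
      · obtain ⟨z, hz, rfl⟩ := Finset.mem_image.1 hi
        have : z ∈ U P (b P z) := by
          refine Finset.mem_filter.2 ⟨hmem P hP z hz, fun z' hz' h => ?_⟩
          exact (hinj P hP hz' hz h).symm
        exact Nat.le_mul_of_pos_left _ (Finset.card_pos.2 ⟨z, this⟩)
      · have : U P i = V i := by
          refine Finset.filter_true_of_mem fun v _ z hz h => ?_
          exact absurd (Finset.mem_image.2 ⟨z, hz, h⟩) hi
        rw [this, mul_one]
    calc (Fintype.piFinset V).card = ∏ i, (V i).card := Fintype.card_piFinset V
      _ ≤ ∏ i, ((U P i).card * (if i ∈ (Z P).image (b P) then (V i).card else 1)) :=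
          Finset.prod_le_prod' fun i _ => h1 i
      _ = (Fintype.piFinset (U P)).card * ∏ z ∈ Z P, (V (b P z)).card := by
          rw [Finset.prod_mul_distrib, Fintype.card_piFinset, Finset.prod_ite_mem,
            Finset.univ_inter, Finset.prod_image (hinj P hP)]
      _ ≤ _ := by
          have := prod_le_pow_of_sum_le (Z P) (fun z => (V (b P z)).card) n
            (by rw [hcard P hP]; exact hsum P hP)
          rw [hcard P hP] at this
          exact Nat.mul_le_mul_left _ this
  have hdisj : (A : Set α).PairwiseDisjoint fun P => Fintype.piFinset (U P) := by
    intro P hP P' hP' hne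
    refine Finset.disjoint_left.2 fun c hc hc' => ?_
    obtain ⟨z, hz, z', hz', hb, hzz⟩ := hsep P hP P' hP' hne
    have e1 := (Finset.mem_filter.1 (Fintype.mem_piFinset.1 hc (b P z))).2 z hz rfl
    have e2 := (Finset.mem_filter.1 (Fintype.mem_piFinset.1 hc' (b P z))).2 z' hz' hb.symm
    exact hzz (e1.symm.trans e2)
  have hsub : A.biUnion (fun P => Fintype.piFinset (U P)) ⊆ Fintype.piFinset V := by
    intro c hc
    obtain ⟨P, -, hc⟩ := Finset.mem_biUnion.1 hc
    exact Fintype.mem_piFinset.2 fun i =>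
      (Finset.mem_filter.1 (Fintype.mem_piFinset.1 hc i)).1
  have hpos : 0 < (Fintype.piFinset V).card := by
    rw [Fintype.card_piFinset]
    exact Finset.prod_pos fun i _ => Finset.card_pos.2 (hV i)
  refine Nat.le_of_mul_le_mul_right ?_ hpos
  calc A.card * (Fintype.piFinset V).card = ∑ P ∈ A, (Fintype.piFinset V).card := by
        simp
    _ ≤ ∑ P ∈ A, (Fintype.piFinset (U P)).card * n ^ a := Finset.sum_le_sum hbound
    _ = (A.biUnion fun P => Fintype.piFinset (U P)).card * n ^ a := by
        rw [← Finset.sum_mul, Finset.card_biUnion hdisj]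
    _ ≤ (Fintype.piFinset V).card * n ^ a :=
        Nat.mul_le_mul_right _ (Finset.card_le_card hsub)
    _ = _ := mul_comm _ _

/-- A vertex `p` of the integer line is unmatched by the set of edges `{r, r + 1}`, `a r`. -/
def Unmatched (a : ℤ → Prop) (p : ℤ) : Prop := ¬ a p ∧ ¬ a (p - 1)

theorem exists_alternating_end (N : ℤ) (d : ℕ) : ∀ (a a' : ℤ → Prop) (p : ℤ),
    (∀ r, a r → ¬ a (r + 1)) → (∀ r, a' r → ¬ a' (r + 1)) →
    (∀ r, N ≤ r → ¬ a r ∧ ¬ a' r) → N - p ≤ d → a' p → ¬ a p →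
    ∃ q, p < q ∧ (∀ r, p ≤ r → r < q → a r ∨ a' r) ∧
      ((Even (q - p) ∧ Unmatched a' q ∧ a (q - 1)) ∨
        (¬ Even (q - p) ∧ Unmatched a q ∧ a' (q - 1))) := by
  induction d with
  | zero =>
    intro a a' p _ _ hN hd h _
    exact absurd h (hN p (by simpa using hd)).2
  | succ d ih =>
    intro a a' p ha ha' hN hd h h0
    by_cases h1 : a (p + 1)
    · obtain ⟨q, hq, hr, h2⟩ := ih a' a (p + 1) ha' ha (fun r hr => (hN r hr).symm)
        (by push_cast at hd; omega) h1 (ha' p h)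
      refine ⟨q, by omega, fun r h3 h4 => ?_, ?_⟩
      · rcases eq_or_lt_of_le h3 with rfl | h3
        · exact Or.inr h
        · exact (hr r (by omega) h4).symm
      · have he : Even (q - p) ↔ ¬ Even (q - (p + 1)) := by
          simp only [Int.even_iff]; omega
        rw [he, not_not]
        tauto
    · refine ⟨p + 1, by omega, fun r h3 h4 => ?_, Or.inr ⟨by simp, ⟨h1, ?_⟩, ?_⟩⟩
      · obtain rfl : r = p := by omega
        exact Or.inr h
      · simpa using h0
      · simpa using h

theorem exists_unmatched_of_edge_right {a a' : ℤ → Prop} (ha : ∀ r, a r → ¬ a (r + 1))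
    (ha' : ∀ r, a' r → ¬ a' (r + 1)) {N : ℤ} (hN : ∀ r, N ≤ r → ¬ a r ∧ ¬ a' r)
    (heven : ∀ r, Even r → (Unmatched a r ↔ Unmatched a' r)) {p : ℤ} (hp : ¬ Even p)
    (hu : Unmatched a p) (h : a' p) :
    ∃ q, ¬ Even q ∧ q ≠ p ∧ Unmatched a' q ∧ ¬ Unmatched a q ∧
      ∀ r, min p q ≤ r → r ≤ max p q → ¬ Unmatched a r ∨ ¬ Unmatched a' r := by
  obtain ⟨q, hq, hr, h1⟩ := exists_alternating_end N (N - p).toNat a a' p ha ha' hN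
    (by omega) h hu.1
  rcases h1 with ⟨he, hq1, hq2⟩ | ⟨he, hq1, hq2⟩
  · refine ⟨q, ?_, hq.ne', hq1, fun hh => hh.2 hq2, fun r h3 h4 => ?_⟩
    · simp only [Int.even_iff] at *; omega
    · rcases eq_or_lt_of_le (show r ≤ q by omega) with rfl | h5
      · exact Or.inl fun hh => hh.2 hq2
      · exact (hr r (by omega) h5).imp (fun h hh => hh.1 h) (fun h hh => hh.1 h)
  · have : Even q := by simp only [Int.even_iff] at *; omega
    exact absurd hq2 ((heven q this).1 hq1).2

theorem exists_unmatched_of_ne {a a' : ℤ → Prop} (ha : ∀ r, a r → ¬ a (r + 1))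
    (ha' : ∀ r, a' r → ¬ a' (r + 1)) {N : ℤ} (hN : ∀ r, N ≤ |r| → ¬ a r ∧ ¬ a' r)
    (heven : ∀ r, Even r → (Unmatched a r ↔ Unmatched a' r)) {p : ℤ} (hp : ¬ Even p)
    (hu : Unmatched a p) (h : ¬ Unmatched a' p) :
    ∃ q, ¬ Even q ∧ q ≠ p ∧ Unmatched a' q ∧ ¬ Unmatched a q ∧
      ∀ r, min p q ≤ r → r ≤ max p q → ¬ Unmatched a r ∨ ¬ Unmatched a' r := by
  by_cases h1 : a' p
  · exact exists_unmatched_of_edge_right ha ha' (fun r hr => hN r (hr.trans (le_abs_self r)))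
      heven hp hu h1
  have h2 : a' (p - 1) := by
    by_contra h2
    exact h ⟨h1, h2⟩
  have hflip : ∀ (e : ℤ → Prop) r, Unmatched (fun r => e (-r - 1)) r ↔ Unmatched e (-r) := by
    intro e r
    have : -(r - 1) - 1 = -r := by ring
    simp only [Unmatched, this, and_comm]
  have hstep : ∀ e : ℤ → Prop, (∀ r, e r → ¬ e (r + 1)) →
      ∀ r, e (-r - 1) → ¬ e (-(r + 1) - 1) := by
    intro e he r h3 h4
    have := he _ h4
    rw [show -(r + 1) - 1 + 1 = -r - 1 by ring] at this
    exact this h3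
  obtain ⟨q, hq1, hq2, hq3, hq4, hq5⟩ := exists_unmatched_of_edge_right
    (a := fun r => a (-r - 1)) (a' := fun r => a' (-r - 1)) (hstep a ha) (hstep a' ha')
    (N := N) (fun r hr => hN _ (by rw [le_abs]; omega))
    (fun r hr => by rw [hflip, hflip]; exact heven _ (by simpa using hr))
    (p := -p) (by simpa using hp) (by rw [hflip]; simpa using hu) (by simpa using h2)
  simp only [hflip] at hq3 hq4 hq5
  refine ⟨-q, by simpa using hq1, by omega, hq3, hq4, fun r h3 h4 => ?_⟩
  simpa using hq5 (-r) (by omega) (by omega)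

theorem edge_of_unmatched_iff {a a' : ℤ → Prop} (ha : ∀ r, a r → ¬ a (r + 1))
    (ha' : ∀ r, a' r → ¬ a' (r + 1)) {N : ℤ} (hN : ∀ r, N ≤ |r| → ¬ a r ∧ ¬ a' r)
    (h : ∀ r, Unmatched a r ↔ Unmatched a' r) {p : ℤ} (hp : a' p) : a p := by
  by_contra h0
  obtain ⟨q, -, -, h1⟩ := exists_alternating_end N (N - p).toNat a a' p ha ha'
    (fun r hr => hN r (hr.trans (le_abs_self r))) (by omega) hp h0
  rcases h1 with ⟨-, hq1, hq2⟩ | ⟨-, hq1, hq2⟩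
  · exact ((h q).2 hq1).2 hq2
  · exact ((h q).1 hq1).2 hq2

theorem exists_even_unmatched {a : ℤ → Prop} (ha : ∀ r, a r → ¬ a (r + 1)) {p q : ℤ}
    (hpq : p < q) (hp : ¬ Even p) (hq : ¬ Even q) (hup : Unmatched a p) (huq : Unmatched a q) :
    ∃ r, p < r ∧ r < q ∧ Even r ∧ Unmatched a r := by
  by_contra! hcon
  have key : ∀ i : ℕ, p + 1 + 2 * i < q → a (p + 1 + 2 * i) := by
    intro i
    induction i with
    | zero =>
      intro hi
      by_contra h
      refine hcon (p + 1) (by omega) (by simpa using hi) ?_ ⟨by simpa using h, ?_⟩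
      · simp only [Int.even_iff] at *; omega
      · simpa using hup.1
    | succ i ih =>
      intro hi
      push_cast at hi ⊢
      by_contra h
      refine hcon (p + 1 + 2 * (i + 1)) (by omega) (by omega) ?_ ⟨h, fun h' => ?_⟩
      · simp only [Int.even_iff] at *; omega
      · refine ha _ (ih (by omega)) ?_
        convert h' using 1
        ring
  have h1 := key ((q - p - 2) / 2).toNat
  have h2 : p + 1 + 2 * (((q - p - 2) / 2).toNat : ℤ) = q - 1 := by
    simp only [Int.even_iff] at *; omega
  rw [h2] at h1
  exact huq.2 (h1 (by omega))

theorem IsRibbon.exists_path {n : ℕ} {T : Finset (ℤ × ℤ)} (h : IsRibbon n T) :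
    ∃ f : ℕ → ℤ × ℤ,
      (∀ i, i + 1 < n → f (i + 1) = f i + (1, 0) ∨ f (i + 1) = f i + (0, 1)) ∧
      (∀ i, i < n → level (f i) = level (f 0) + i) ∧ ∀ s, s ∈ T ↔ ∃ i < n, f i = s := by
  obtain ⟨f, hf, rfl⟩ := h
  refine ⟨f, hf, fun i => ?_, fun s => by simp⟩
  induction i with
  | zero => simp
  | succ i ih =>
    intro hi
    have := ih (by omega)
    rcases hf i hi with h | h <;> rw [h] <;> simp only [level, Prod.fst_add, Prod.snd_add] at * <;>
      push_cast <;> linarith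

theorem IsRibbon.eq_of_level_eq {n : ℕ} {T : Finset (ℤ × ℤ)} (h : IsRibbon n T)
    {s t : ℤ × ℤ} (hs : s ∈ T) (ht : t ∈ T) (hst : level s = level t) : s = t := by
  obtain ⟨f, -, hl, hT⟩ := h.exists_path
  obtain ⟨i, hi, rfl⟩ := (hT s).1 hs
  obtain ⟨j, hj, rfl⟩ := (hT t).1 ht
  rw [hl i hi, hl j hj] at hst
  rw [show i = j by omega]

theorem IsRibbon.card_eq {n : ℕ} {T : Finset (ℤ × ℤ)} (h : IsRibbon n T) : T.card = n := by
  obtain ⟨f, -, hl, hT⟩ := h.exists_path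
  have : T = (Finset.range n).image f := by
    ext s
    rw [hT]
    simp
  rw [this, Finset.card_image_of_injOn, Finset.card_range]
  intro i hi j hj hij
  have h1 := hl i (by simpa using hi)
  have h2 := hl j (by simpa using hj)
  rw [hij] at h1
  omega

/-- Coordinates on the squares of levels `k` (even `p`) and `k + 1` (odd `p`), read from left to
right. -/
def zigzag (k p : ℤ) : ℤ × ℤ := ((p + 1) / 2, k - p / 2)

theorem level_zigzag_even {k p : ℤ} (hp : Even p) : level (zigzag k p) = k := by
  simp only [level, zigzag, Int.even_iff] at *
  omega

theorem level_zigzag_odd {k p : ℤ} (hp : ¬ Even p) : level (zigzag k p) = k + 1 := by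
  simp only [level, zigzag, Int.even_iff] at *
  omega

theorem zigzag_injective (k : ℤ) : Function.Injective (zigzag k) := by
  intro p q h
  simp only [zigzag, Prod.mk.injEq] at h
  omega

theorem zigzag_level (s : ℤ × ℤ) : zigzag (level s) (2 * s.1) = s := by
  ext <;> simp only [zigzag, level] <;> omega

theorem zigzag_level_sub_one (s : ℤ × ℤ) : zigzag (level s - 1) (2 * s.1 - 1) = s := by
  ext <;> simp only [zigzag, level] <;> omega

/-- Two squares lie in a common tile of `P`. -/
def SameTile (P : Finset (Finset (ℤ × ℤ))) (s t : ℤ × ℤ) : Prop := ∃ T ∈ P, s ∈ T ∧ t ∈ T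

/-- The neighbours `p`, `p + 1` of the zigzag between levels `k` and `k + 1` share a tile. -/
def Linked (P : Finset (Finset (ℤ × ℤ))) (k p : ℤ) : Prop :=
  SameTile P (zigzag k p) (zigzag k (p + 1))

/-- `s` is the last square of a tile of `P`. -/
def IsEnd (P : Finset (Finset (ℤ × ℤ))) (s : ℤ × ℤ) : Prop :=
  ∃ T ∈ P, s ∈ T ∧ ∀ t ∈ T, level t ≤ level s

section Tiling

variable {n : ℕ} {R : Finset (ℤ × ℤ)} {P P' : Finset (Finset (ℤ × ℤ))}

theorem IsTiling.mem_iff (h : IsTiling n R P) {s : ℤ × ℤ} : s ∈ R ↔ ∃ T ∈ P, s ∈ T := by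
  rw [← h.2.2]
  simp

theorem IsTiling.eq_of_mem (h : IsTiling n R P) {T T' : Finset (ℤ × ℤ)} (hT : T ∈ P)
    (hT' : T' ∈ P) {s : ℤ × ℤ} (hs : s ∈ T) (hs' : s ∈ T') : T = T' := by
  by_contra hne
  exact Finset.disjoint_left.1 (h.2.1 hT hT' hne) hs hs'

theorem IsTiling.card_eq (h : IsTiling n R P) : R.card = P.card * n := by
  rw [← h.2.2, Finset.card_biUnion h.2.1]
  simp only [id]
  rw [Finset.sum_congr rfl fun T hT => (h.1 T hT).card_eq]
  simp

theorem IsTiling.mem_of_linked (h : IsTiling n R P) {k p : ℤ} (hl : Linked P k p) :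
    zigzag k p ∈ R ∧ zigzag k (p + 1) ∈ R := by
  obtain ⟨T, hT, h1, h2⟩ := hl
  exact ⟨h.mem_iff.2 ⟨T, hT, h1⟩, h.mem_iff.2 ⟨T, hT, h2⟩⟩

theorem IsTiling.not_linked_succ (h : IsTiling n R P) {k : ℤ} (p : ℤ) (hl : Linked P k p) :
    ¬ Linked P k (p + 1) := by
  rintro ⟨T', hT', h3, h4⟩
  obtain ⟨T, hT, h1, h2⟩ := hl
  obtain rfl := h.eq_of_mem hT hT' h2 h3
  have : zigzag k p = zigzag k (p + 1 + 1) := (h.1 T hT).eq_of_level_eq h1 h4 (by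
    simp only [level, zigzag]; omega)
  have := zigzag_injective k this
  omega

theorem IsTiling.mem_of_not_unmatched (h : IsTiling n R P) {k p : ℤ}
    (hu : ¬ Unmatched (Linked P k) p) : zigzag k p ∈ R := by
  by_contra hR
  refine hu ⟨fun hl => hR (h.mem_of_linked hl).1, fun hl => hR ?_⟩
  simpa using (h.mem_of_linked hl).2

theorem exists_zigzag_notMem (R : Finset (ℤ × ℤ)) (k : ℤ) :
    ∃ N : ℤ, ∀ p, N ≤ |p| → zigzag k p ∉ R := by
  obtain ⟨N, hN⟩ := (R.image fun s => |s.1|).exists_le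
  refine ⟨2 * N + 3, fun p hp hR => ?_⟩
  have := hN _ (Finset.mem_image_of_mem _ hR)
  simp only [zigzag] at this
  rw [abs_le] at this
  rw [le_abs] at hp
  omega

theorem IsTiling.isEnd_iff (h : IsTiling n R P) {k p : ℤ} (hp : Even p) :
    IsEnd P (zigzag k p) ↔ zigzag k p ∈ R ∧ Unmatched (Linked P k) p := by
  have hodd : ¬ Even (p + 1) ∧ ¬ Even (p - 1) := by
    simp only [Int.even_iff] at *; omega
  constructor
  · rintro ⟨T, hT, hs, hmax⟩
    refine ⟨h.mem_iff.2 ⟨T, hT, hs⟩, ?_, ?_⟩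
    · rintro ⟨T', hT', h1, h2⟩
      obtain rfl := h.eq_of_mem hT hT' hs h1
      have := hmax _ h2
      rw [level_zigzag_even hp, level_zigzag_odd hodd.1] at this
      omega
    · rintro ⟨T', hT', h1, h2⟩
      rw [sub_add_cancel] at h2
      obtain rfl := h.eq_of_mem hT hT' hs h2
      have := hmax _ h1
      rw [level_zigzag_even hp, level_zigzag_odd hodd.2] at this
      omega
  · rintro ⟨hR, hu⟩
    obtain ⟨T, hT, hs⟩ := h.mem_iff.1 hR
    obtain ⟨f, hstep, hl, hf⟩ := (h.1 T hT).exists_path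
    obtain ⟨i, hi, his⟩ := (hf _).1 hs
    refine ⟨T, hT, hs, fun t ht => ?_⟩
    obtain ⟨j, hj, rfl⟩ := (hf t).1 ht
    by_contra hlt
    rw [← his, hl i hi, hl j hj] at hlt
    have hi1 : i + 1 < n := by omega
    have hmem : f (i + 1) ∈ T := (hf _).2 ⟨i + 1, hi1, rfl⟩
    rcases hstep i hi1 with h1 | h1
    · refine hu.1 ⟨T, hT, hs, ?_⟩
      convert hmem using 1
      rw [h1, his]
      ext <;> simp only [zigzag, Int.even_iff, Prod.fst_add, Prod.snd_add] at * <;> omega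
    · refine hu.2 ⟨T, hT, ?_, by rwa [sub_add_cancel]⟩
      convert hmem using 1
      rw [h1, his]
      ext <;> simp only [zigzag, Int.even_iff, Prod.fst_add, Prod.snd_add] at * <;> omega

theorem IsTiling.mem_rootSet_iff (h : IsTiling n R P) {k p : ℤ} (hp : ¬ Even p) :
    zigzag k p ∈ rootSet P ↔ zigzag k p ∈ R ∧ Unmatched (Linked P k) p := by
  have heven : Even (p + 1) ∧ Even (p - 1) := by
    simp only [Int.even_iff] at *; omega
  constructor
  · rintro ⟨T, hT, hs, hmin⟩
    refine ⟨h.mem_iff.2 ⟨T, hT, hs⟩, ?_, ?_⟩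
    · rintro ⟨T', hT', h1, h2⟩
      obtain rfl := h.eq_of_mem hT hT' hs h1
      have := hmin _ h2
      rw [level_zigzag_odd hp, level_zigzag_even heven.1] at this
      omega
    · rintro ⟨T', hT', h1, h2⟩
      rw [sub_add_cancel] at h2
      obtain rfl := h.eq_of_mem hT hT' hs h2
      have := hmin _ h1
      rw [level_zigzag_odd hp, level_zigzag_even heven.2] at this
      omega
  · rintro ⟨hR, hu⟩
    obtain ⟨T, hT, hs⟩ := h.mem_iff.1 hR
    obtain ⟨f, hstep, hl, hf⟩ := (h.1 T hT).exists_path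
    obtain ⟨i, hi, his⟩ := (hf _).1 hs
    refine ⟨T, hT, hs, fun t ht => ?_⟩
    obtain ⟨j, hj, rfl⟩ := (hf t).1 ht
    by_contra hlt
    rw [← his, hl i hi, hl j hj] at hlt
    obtain ⟨i, rfl⟩ : ∃ i', i = i' + 1 := ⟨i - 1, by omega⟩
    have hmem : f i ∈ T := (hf _).2 ⟨i, by omega, rfl⟩
    rcases hstep i hi with h1 | h1
    · refine hu.2 ⟨T, hT, ?_, by rwa [sub_add_cancel]⟩
      convert hmem using 1
      rw [his] at h1
      rw [← sub_eq_iff_eq_add] at h1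
      rw [← h1]
      ext <;> simp only [zigzag, Int.even_iff, Prod.fst_sub, Prod.snd_sub] at * <;> omega
    · refine hu.1 ⟨T, hT, hs, ?_⟩
      convert hmem using 1
      rw [his] at h1
      rw [← sub_eq_iff_eq_add] at h1
      rw [← h1]
      ext <;> simp only [zigzag, Int.even_iff, Prod.fst_sub, Prod.snd_sub] at * <;> omega

/-- A tile all of whose links persist in another tiling is a tile of that tiling. -/
theorem IsTiling.mem_of_linked_imp (h : IsTiling n R P) (h' : IsTiling n R P') (hn : 0 < n)
    {T : Finset (ℤ × ℤ)} (hT : T ∈ P)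
    (hlink : ∀ k p, zigzag k p ∈ T → zigzag k (p + 1) ∈ T → Linked P' k p) : T ∈ P' := by
  obtain ⟨f, hstep, hl, hf⟩ := (h.1 T hT).exists_path
  have hmem : ∀ i < n, f i ∈ T := fun i hi => (hf _).2 ⟨i, hi, rfl⟩
  obtain ⟨T', hT', h0⟩ := h'.mem_iff.1 (h.mem_iff.2 ⟨T, hT, hmem 0 hn⟩)
  have key : ∀ i, i < n → f i ∈ T' := by
    intro i
    induction i with
    | zero => exact fun _ => h0
    | succ i ih =>
      intro hi
      have hi' := ih (by omega)
      have hs : SameTile P' (f i) (f (i + 1)) := by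
        have h1 : zigzag (level (f i)) (2 * (f i).1) = f i := zigzag_level _
        rcases hstep i hi with h2 | h2
        · have h3 : zigzag (level (f i)) (2 * (f i).1 + 1) = f (i + 1) := by
            rw [h2]
            ext <;> simp only [zigzag, level, Prod.fst_add, Prod.snd_add] <;> omega
          have := hlink (level (f i)) (2 * (f i).1) (by rw [h1]; exact hmem i (by omega))
            (by rw [h3]; exact hmem _ hi)
          rwa [Linked, h1, h3] at this
        · have h3 : zigzag (level (f i)) (2 * (f i).1 - 1) = f (i + 1) := by
            rw [h2]
            ext <;> simp only [zigzag, level, Prod.fst_add, Prod.snd_add] <;> omega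
          have := hlink (level (f i)) (2 * (f i).1 - 1) (by rw [h3]; exact hmem _ hi)
            (by rw [sub_add_cancel, h1]; exact hmem i (by omega))
          rw [Linked, sub_add_cancel, h1, h3] at this
          obtain ⟨T, hT, h4, h5⟩ := this
          exact ⟨T, hT, h5, h4⟩
      obtain ⟨T'', hT'', h1, h2⟩ := hs
      rwa [h'.eq_of_mem hT' hT'' hi' h1]
  have hsub : T ⊆ T' := by
    intro s hs
    obtain ⟨i, hi, rfl⟩ := (hf s).1 hs
    exact key i hi
  rwa [Finset.eq_of_subset_of_card_le hsub
    (by rw [(h.1 T hT).card_eq, (h'.1 T' hT').card_eq])]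

theorem IsTiling.isEnd_of_linked_imp (h : IsTiling n R P) (h' : IsTiling n R P') (hn : 0 < n)
    {s : ℤ × ℤ} (hlink : ∀ k < level s, ∀ p, Linked P k p → Linked P' k p)
    (hs : IsEnd P s) : IsEnd P' s := by
  obtain ⟨T, hT, hsT, hmax⟩ := hs
  refine ⟨T, h.mem_of_linked_imp h' hn hT (fun k p h1 h2 => ?_), hsT, hmax⟩
  refine hlink k ?_ p ⟨T, hT, h1, h2⟩
  have h3 := hmax _ h1
  have h4 := hmax _ h2
  simp only [level, zigzag] at *
  omega

/-- The squares `p` and `q` of the zigzag can be joined without meeting the complement of `R` or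
the end of a tile. -/
def LevelJoined (R : Finset (ℤ × ℤ)) (P : Finset (Finset (ℤ × ℤ))) (k p q : ℤ) : Prop :=
  ∀ r, min p q ≤ r → r ≤ max p q → zigzag k r ∈ R ∧ (Even r → ¬ IsEnd P (zigzag k r))

theorem LevelJoined.symm {k p q : ℤ} (h : LevelJoined R P k p q) : LevelJoined R P k q p := by
  intro r h1 h2
  exact h r (by omega) (by omega)

theorem LevelJoined.trans {k p q r : ℤ} (h : LevelJoined R P k p q) (h' : LevelJoined R P k q r) :
    LevelJoined R P k p r := by
  intro x h1 h2
  by_cases hx : min p q ≤ x ∧ x ≤ max p q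
  · exact h x hx.1 hx.2
  · exact h' x (by omega) (by omega)

/-- The squares on the level of `z` that can be joined to `z`. -/
noncomputable def block (R : Finset (ℤ × ℤ)) (P : Finset (Finset (ℤ × ℤ))) (z : ℤ × ℤ) :
    Finset (ℤ × ℤ) :=
  R.filter fun w => level w = level z ∧ LevelJoined R P (level z - 1) (2 * z.1 - 1) (2 * w.1 - 1)

theorem mem_block_self {z : ℤ × ℤ} (hz : z ∈ R) : z ∈ block R P z := by
  refine Finset.mem_filter.2 ⟨hz, rfl, fun r h1 h2 => ?_⟩
  obtain rfl : r = 2 * z.1 - 1 := by omega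
  refine ⟨by rwa [zigzag_level_sub_one], fun h => ?_⟩
  rw [Int.even_iff] at h
  omega

theorem IsTiling.eq_of_mem_block (h : IsTiling n R P) {z z' w : ℤ × ℤ} (hz : z ∈ rootSet P)
    (hz' : z' ∈ rootSet P) (hw : w ∈ block R P z) (hw' : w ∈ block R P z') : z = z' := by
  obtain ⟨-, hl, hj⟩ := Finset.mem_filter.1 hw
  obtain ⟨-, hl', hj'⟩ := Finset.mem_filter.1 hw'
  rw [← hl', hl] at hj'
  have hj'' := hj.trans hj'.symm
  have hodd : ∀ x : ℤ, ¬ Even (2 * x - 1) := fun x => by rw [Int.even_iff]; omega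
  have e1 := zigzag_level_sub_one z
  have e2 := zigzag_level_sub_one z'
  rw [← hl', hl] at e2
  rw [← e1, h.mem_rootSet_iff (hodd _)] at hz
  rw [← e2, h.mem_rootSet_iff (hodd _)] at hz'
  by_contra hne
  have hne' : 2 * z.1 - 1 ≠ 2 * z'.1 - 1 := fun h => hne (by rw [← e1, ← e2, h])
  rcases lt_or_gt_of_ne hne' with hlt | hlt
  · obtain ⟨r, h1, h2, h3, h4⟩ := exists_even_unmatched (h.not_linked_succ (k := level z - 1))
      hlt (hodd _) (hodd _) hz.2 hz'.2
    have := hj'' r (by omega) (by omega)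
    exact this.2 h3 ((h.isEnd_iff h3).2 ⟨this.1, h4⟩)
  · obtain ⟨r, h1, h2, h3, h4⟩ := exists_even_unmatched (h.not_linked_succ (k := level z - 1))
      hlt (hodd _) (hodd _) hz'.2 hz.2
    have := hj'' r (by omega) (by omega)
    exact this.2 h3 ((h.isEnd_iff h3).2 ⟨this.1, h4⟩)

theorem IsTiling.unmatched_of_separated (h : IsTiling n R P) (h' : IsTiling n R P')
    {k : ℤ} (hend : ∀ s, level s = k → (IsEnd P s ↔ IsEnd P' s))
    (hsep : ∀ z ∈ rootSet P, ∀ z' ∈ rootSet P', block R P z = block R P' z' → z = z')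
    (p : ℤ) (hu : Unmatched (Linked P k) p) : Unmatched (Linked P' k) p := by
  have heven : ∀ r, Even r → (Unmatched (Linked P k) r ↔ Unmatched (Linked P' k) r) := by
    intro r hr
    have h1 := hend _ (level_zigzag_even hr)
    rw [h.isEnd_iff hr, h'.isEnd_iff hr] at h1
    by_cases hR : zigzag k r ∈ R
    · tauto
    · have h2 := mt h.mem_of_not_unmatched hR
      have h3 := mt h'.mem_of_not_unmatched hR
      tauto
  by_cases hp : Even p
  · exact (heven p hp).1 hu
  by_contra hu'
  obtain ⟨N, hN⟩ := exists_zigzag_notMem R k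
  obtain ⟨q, hq, hqp, hq1, hq2, hq3⟩ := exists_unmatched_of_ne h.not_linked_succ
    h'.not_linked_succ (N := N) (fun r hr => ⟨fun hl => hN r hr (h.mem_of_linked hl).1,
      fun hl => hN r hr (h'.mem_of_linked hl).1⟩) heven hp hu hu'
  have hz := (h.mem_rootSet_iff hp).2 ⟨h'.mem_of_not_unmatched hu', hu⟩
  have hz' := (h'.mem_rootSet_iff hq).2 ⟨h.mem_of_not_unmatched hq2, hq1⟩
  have hjoin : LevelJoined R P k p q := by
    intro r h1 h2
    refine ⟨(hq3 r h1 h2).elim h.mem_of_not_unmatched h'.mem_of_not_unmatched, fun hr he => ?_⟩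
    have := heven r hr
    have := ((h.isEnd_iff hr).1 he).2
    have := hq3 r h1 h2
    tauto
  have hiff : ∀ x y, LevelJoined R P k x y ↔ LevelJoined R P' k x y := by
    intro x y
    refine forall_congr' fun r => imp_congr_right fun _ => imp_congr_right fun _ =>
      and_congr_right fun _ => imp_congr_right fun hr => ?_
    rw [hend _ (level_zigzag_even hr)]
  have hx : ∀ r : ℤ, ¬ Even r → 2 * (zigzag k r).1 - 1 = r := by
    intro r hr
    simp only [zigzag, Int.even_iff] at *
    omega
  have hblock : block R P (zigzag k p) = block R P' (zigzag k q) := by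
    ext w
    simp only [block, Finset.mem_filter, level_zigzag_odd hp, level_zigzag_odd hq, hx p hp,
      hx q hq, add_sub_cancel_right, ← hiff]
    exact and_congr_right fun _ => and_congr_right fun _ =>
      ⟨fun hh => hjoin.symm.trans hh, fun hh => hjoin.trans hh⟩
  exact hqp (zigzag_injective k (hsep _ hz _ hz' hblock)).symm

theorem IsTiling.eq_of_separated (h : IsTiling n R P) (h' : IsTiling n R P') (hn : 0 < n)
    (hsep : ∀ z ∈ rootSet P, ∀ z' ∈ rootSet P', block R P z = block R P' z' → z = z') :
    P = P' := by
  have hsep' : ∀ z ∈ rootSet P', ∀ z' ∈ rootSet P, block R P' z = block R P z' → z = z' :=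
    fun z hz z' hz' hb => (hsep z' hz' z hz hb.symm).symm
  obtain ⟨K, hK⟩ := (R.image level).bddBelow
  have key : ∀ d : ℕ, ∀ k < K - 1 + d, ∀ p, Linked P k p ↔ Linked P' k p := by
    intro d
    induction d with
    | zero =>
      intro k hk p
      have hR : zigzag k p ∉ R := by
        intro hR
        have := hK (Finset.mem_coe.2 (Finset.mem_image_of_mem level hR))
        simp only [level, zigzag] at this
        omega
      exact ⟨fun hl => absurd (h.mem_of_linked hl).1 hR,
        fun hl => absurd (h'.mem_of_linked hl).1 hR⟩
    | succ d ih =>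
      intro k hk p
      push_cast at hk
      have hend : ∀ s, level s = k → (IsEnd P s ↔ IsEnd P' s) := fun s hs =>
        ⟨h.isEnd_of_linked_imp h' hn fun j hj p => (ih j (by omega) p).1,
          h'.isEnd_of_linked_imp h hn fun j hj p => (ih j (by omega) p).2⟩
      have hu : ∀ r, Unmatched (Linked P k) r ↔ Unmatched (Linked P' k) r := fun r =>
        ⟨h.unmatched_of_separated h' hend hsep r,
          h'.unmatched_of_separated h (fun s hs => (hend s hs).symm) hsep' r⟩
      obtain ⟨N, hN⟩ := exists_zigzag_notMem R k
      have hN1 : ∀ r, N ≤ |r| → ¬ Linked P k r ∧ ¬ Linked P' k r := fun r hr =>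
        ⟨fun hl => hN r hr (h.mem_of_linked hl).1, fun hl => hN r hr (h'.mem_of_linked hl).1⟩
      exact ⟨edge_of_unmatched_iff h'.not_linked_succ h.not_linked_succ
          (fun r hr => (hN1 r hr).symm) fun r => (hu r).symm,
        edge_of_unmatched_iff h.not_linked_succ h'.not_linked_succ hN1 hu⟩
  have hall : ∀ k p, Linked P k p ↔ Linked P' k p := fun k p =>
    key (k + 2 - K).toNat k (by omega) p
  ext T
  exact ⟨fun hT => h.mem_of_linked_imp h' hn hT fun k p h1 h2 =>
      (hall k p).1 ⟨T, hT, h1, h2⟩,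
    fun hT => h'.mem_of_linked_imp h hn hT fun k p h1 h2 => (hall k p).2 ⟨T, hT, h1, h2⟩⟩

theorem IsTiling.rootSet_subset (h : IsTiling n R P) {z : ℤ × ℤ} (hz : z ∈ rootSet P) :
    z ∈ R := by
  obtain ⟨T, hT, hs, -⟩ := hz
  exact h.mem_iff.2 ⟨T, hT, hs⟩

theorem IsTiling.card_roots (h : IsTiling n R P) (hn : 0 < n) :
    (R.filter (· ∈ rootSet P)).card = P.card := by
  symm
  have hex : ∀ T ∈ P, ∃ s, IsRoot T s := fun T hT =>
    Finset.exists_min_image T level (Finset.card_pos.1 (by rwa [(h.1 T hT).card_eq]))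
  choose! ρ hρ using hex
  refine Finset.card_bij (fun T _ => ρ T) (fun T hT => ?_) (fun T hT T' hT' he => ?_)
    fun s hs => ?_
  · have : ρ T ∈ rootSet P := ⟨T, hT, hρ T hT⟩
    exact Finset.mem_filter.2 ⟨h.rootSet_subset this, this⟩
  · exact h.eq_of_mem hT hT' (hρ T hT).1 (he ▸ (hρ T' hT').1)
  · obtain ⟨T, hT, hs⟩ := (Finset.mem_filter.1 hs).2
    exact ⟨T, hT, (h.1 T hT).eq_of_level_eq (hρ T hT).1 hs.1
      (le_antisymm ((hρ T hT).2 _ hs.1) (hs.2 _ (hρ T hT).1))⟩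

end Tiling

theorem finite_setOf_isTiling (n : ℕ) (R : Finset (ℤ × ℤ)) : {P | IsTiling n R P}.Finite := by
  refine (R.powerset.powerset.finite_toSet).subset fun P hP => ?_
  simp only [Finset.coe_powerset, Set.mem_preimage, Set.mem_powerset_iff]
  intro T hT
  have hT' : T ⊆ R := fun s hs => hP.mem_iff.2 ⟨T, hT, hs⟩
  simpa using hT'

theorem tilingCount_le_pow {n a : ℕ} (hn : 0 < n) {R : Finset (ℤ × ℤ)} (hR : R.card = a * n) :
    TilingCount n R ≤ n ^ a := by
  rw [TilingCount, Set.ncard_eq_toFinset_card _ (finite_setOf_isTiling n R)]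
  have hA : ∀ P ∈ (finite_setOf_isTiling n R).toFinset, IsTiling n R P := by simp
  have hself : ∀ P, ∀ z ∈ R.filter (· ∈ rootSet P), z ∈ block R P z := fun P z hz =>
    mem_block_self (Finset.mem_filter.1 hz).1
  have hV : ∀ P z, z ∈ R.filter (· ∈ rootSet P) →
      (if (block R P z).Nonempty then block R P z else {(0, 0)}) = block R P z := fun P z hz =>
    if_pos ⟨z, hself P z hz⟩
  refine card_le_pow_of_separated
    (fun B : R.powerset => if B.1.Nonempty then B.1 else {(0, 0)}) (fun B => ?_) _
    (fun P => R.filter (· ∈ rootSet P))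
    (fun P z => ⟨block R P z, Finset.mem_powerset.2 (Finset.filter_subset _ _)⟩) n a
    (fun P hP z hz z' hz' hb => ?_) (fun P hP z hz => ?_) (fun P hP => ?_) (fun P hP => ?_)
    (fun P hP P' hP' hne => ?_)
  · split_ifs with hB
    · exact hB
    · simp
  · have hb' : block R P z = block R P z' := congrArg Subtype.val hb
    exact (hA P hP).eq_of_mem_block (Finset.mem_filter.1 hz).2 (Finset.mem_filter.1 hz').2
      (hself P z hz) (hb' ▸ hself P z hz)
  · rw [hV P z hz]
    exact hself P z hz
  · rw [(hA P hP).card_roots hn]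
    exact Nat.eq_of_mul_eq_mul_right hn ((hA P hP).card_eq.symm.trans hR)
  · rw [Finset.sum_congr rfl fun z hz => congrArg Finset.card (hV P z hz),
      ← Finset.card_biUnion, ← hR]
    · exact Finset.card_le_card (Finset.biUnion_subset.2 fun z _ => Finset.filter_subset _ _)
    · intro z hz z' hz' hne
      refine Finset.disjoint_left.2 fun w hw hw' => hne ?_
      exact (hA P hP).eq_of_mem_block (Finset.mem_filter.1 hz).2 (Finset.mem_filter.1 hz').2 hw hw'
  · by_contra! hcon
    refine hne ((hA P hP).eq_of_separated (hA P' hP') hn fun z hz z' hz' hb => ?_)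
    exact hcon z (Finset.mem_filter.2 ⟨(hA P hP).rootSet_subset hz, hz⟩) z'
      (Finset.mem_filter.2 ⟨(hA P' hP').rootSet_subset hz', hz'⟩) (Subtype.ext hb)

theorem exists_notMem_card_filter_lt_eq (S F : Finset ℝ) {c : ℕ} (hc : c ≤ S.card) :
    ∃ x ∉ F, (S.filter (· < x)).card = c := by
  rcases hc.eq_or_lt with rfl | hc
  · obtain ⟨M, hM⟩ := (S ∪ F).exists_le
    refine ⟨M + 1, fun h => ?_, ?_⟩
    · have := hM _ (Finset.mem_union_right S h)
      linarith
    · rw [Finset.filter_true_of_mem fun x hx => ?_]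
      have := hM _ (Finset.mem_union_left F hx)
      linarith
  · set e := S.orderEmbOfFin rfl with he
    set s := e ⟨c, hc⟩ with hs
    have hlt : (S.filter (· < s)).card = c := by
      have : S.filter (· < s) = (Finset.univ.filter (· < (⟨c, hc⟩ : Fin S.card))).image e := by
        ext x
        have hx : x ∈ S ↔ ∃ i, e i = x := by
          rw [← Finset.mem_coe, ← Finset.range_orderEmbOfFin S rfl]
          rfl
        simp only [Finset.mem_filter, Finset.mem_image, Finset.mem_univ, true_and, hx]
        constructor
        · rintro ⟨⟨i, rfl⟩, hi⟩
          exact ⟨i, e.lt_iff_lt.1 hi, rfl⟩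
        · rintro ⟨i, hi, rfl⟩
          exact ⟨⟨i, rfl⟩, e.lt_iff_lt.2 hi⟩
      rw [this, Finset.card_image_of_injective _ e.injective]
      convert Fin.card_Iio (⟨c, hc⟩ : Fin S.card) using 2
      ext i
      rw [Finset.mem_filter, Finset.mem_Iio]
      exact and_iff_right (Finset.mem_univ i)
    have hev : ∀ᶠ x in nhdsWithin s (Set.Iio s), ∀ g ∈ (S ∪ F).filter (· < s), g < x := by
      rw [Filter.eventually_all_finset]
      intro g hg
      exact eventually_nhdsWithin_of_eventually_nhds
        (lt_mem_nhds (Finset.mem_filter.1 hg).2)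
    obtain ⟨x, hx, hxs⟩ := (hev.and self_mem_nhdsWithin).exists
    have hxs : x < s := hxs
    refine ⟨x, fun h => ?_, ?_⟩
    · exact lt_irrefl x (hx x (Finset.mem_filter.2 ⟨Finset.mem_union_right S h, hxs⟩))
    · rw [← hlt]
      congr 1
      refine Finset.filter_congr fun y hy => ⟨fun h => h.trans hxs, fun h => ?_⟩
      exact hx y (Finset.mem_filter.2 ⟨Finset.mem_union_left F hy, h⟩)

/-- The prescribed rank of each element among its `n` predecessors is realised by some order. -/
theorem exists_injOn_card_eq (n : ℕ) (c : ℕ → ℕ) (hc : ∀ l, c l ≤ l - (l - n)) (L : ℕ) :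
    ∃ ρ : ℕ → ℝ, Set.InjOn ρ (Set.Iio L) ∧
      ∀ l < L, ((Finset.Ico (l - n) l).filter (fun m => ρ m < ρ l)).card = c l := by
  induction L with
  | zero => exact ⟨fun _ => 0, by simp, by simp⟩
  | succ L ih =>
    obtain ⟨ρ, hinj, hρ⟩ := ih
    have hIco : Set.InjOn ρ (Finset.Ico (L - n) L : Finset ℕ) :=
      hinj.mono fun x hx => by simpa using (Finset.mem_Ico.1 (Finset.mem_coe.1 hx)).2
    obtain ⟨x, hxF, hx⟩ := exists_notMem_card_filter_lt_eq ((Finset.Ico (L - n) L).image ρ)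
      ((Finset.range L).image ρ) (c := c L)
      (by rw [Finset.card_image_of_injOn hIco, Nat.card_Ico]; exact hc L)
    have hne : ∀ m < L, Function.update ρ L x m = ρ m := fun m hm =>
      Function.update_of_ne hm.ne _ _
    have hnx : ∀ m < L, ρ m ≠ x := fun m hm h =>
      hxF (Finset.mem_image.2 ⟨m, Finset.mem_range.2 hm, h⟩)
    refine ⟨Function.update ρ L x, fun i hi j hj hij => ?_, fun l hl => ?_⟩
    · rcases (Nat.lt_succ_iff.1 hi).lt_or_eq with hi | rfl <;>
        rcases (Nat.lt_succ_iff.1 hj).lt_or_eq with hj | rfl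
      · rw [hne i hi, hne j hj] at hij
        exact hinj hi hj hij
      · rw [hne i hi, Function.update_self] at hij
        exact absurd hij (hnx i hi)
      · rw [hne j hj, Function.update_self] at hij
        exact absurd hij.symm (hnx j hj)
      · rfl
    · have hfil : ∀ y, (Finset.Ico (l - n) l).filter (fun m => Function.update ρ L x m < y) =
          (Finset.Ico (l - n) l).filter (fun m => ρ m < y) := fun y =>
        Finset.filter_congr fun m hm => by
          rw [hne m (by have := Finset.mem_Ico.1 hm; omega)]
      rw [hfil]
      rcases (Nat.lt_succ_iff.1 hl).lt_or_eq with hl | rfl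
      · rw [hne l hl, hρ l hl]
      · rw [Function.update_self, ← hx, Finset.filter_image, Finset.card_image_of_injOn]
        exact hIco.mono (Finset.coe_subset.2 (Finset.filter_subset _ _))

/-- The number of elements of `W` placed before `l` by `ρ`. -/
noncomputable def rank (ρ : ℕ → ℝ) (W : Finset ℕ) (l : ℕ) : ℕ :=
  (W.filter (fun m => ρ m < ρ l)).card

theorem rank_lt_rank {ρ : ℕ → ℝ} {W : Finset ℕ} {l m : ℕ} (hl : l ∈ W) (h : ρ l < ρ m) :
    rank ρ W l < rank ρ W m := by
  refine Finset.card_lt_card (Finset.ssubset_iff_of_subset ?_ |>.2 ⟨l, ?_, ?_⟩)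
  · exact Finset.monotone_filter_right _ fun x _ hx => lt_trans hx h
  · exact Finset.mem_filter.2 ⟨hl, h⟩
  · simp

theorem rank_lt_rank_iff {ρ : ℕ → ℝ} {W : Finset ℕ} {l m : ℕ} (hl : l ∈ W) :
    rank ρ W l < rank ρ W m ↔ ρ l < ρ m := by
  refine ⟨fun h => ?_, rank_lt_rank hl⟩
  by_contra! hle
  exact h.not_ge (Finset.card_le_card
    (Finset.monotone_filter_right _ fun x _ hx => lt_of_lt_of_le hx hle))

theorem rank_lt_card {ρ : ℕ → ℝ} {W : Finset ℕ} {l : ℕ} (hl : l ∈ W) :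
    rank ρ W l < W.card :=
  Finset.card_lt_card (Finset.filter_ssubset.2 ⟨l, hl, lt_irrefl _⟩)

theorem rank_injOn {ρ : ℕ → ℝ} {W : Finset ℕ} (hρ : Set.InjOn ρ W) :
    Set.InjOn (rank ρ W) W := by
  intro l hl m hm h
  by_contra hne
  rcases lt_or_gt_of_ne (fun he => hne (hρ hl hm he)) with h1 | h1
  · exact (rank_lt_rank hl h1).ne h
  · exact (rank_lt_rank hm h1).ne' h

theorem image_rank {ρ : ℕ → ℝ} {W : Finset ℕ} (hρ : Set.InjOn ρ W) :
    W.image (rank ρ W) = Finset.range W.card := by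
  refine Finset.eq_of_subset_of_card_le (fun x hx => ?_) ?_
  · obtain ⟨l, hl, rfl⟩ := Finset.mem_image.1 hx
    exact Finset.mem_range.2 (rank_lt_card hl)
  · rw [Finset.card_image_of_injOn (rank_injOn hρ), Finset.card_range]

/-- The tiles `l < L`, the `l`-th one starting at level `l`, that meet level `k`. -/
def window (n L k : ℕ) : Finset ℕ := (Finset.range L).filter (fun l => l ≤ k ∧ k < l + n)

theorem mem_window {n L k l : ℕ} : l ∈ window n L k ↔ l < L ∧ l ≤ k ∧ k < l + n := by
  simp [window]

/-- The `j`-th square from the left at level `k` of the stair with steps `s`. -/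
noncomputable def stairSquare (s : ℕ → Prop) (k j : ℕ) : ℤ × ℤ :=
  ((Nat.count s (k + 1) + j : ℕ), (k : ℤ) - (Nat.count s (k + 1) + j : ℕ))

/-- The stair region with steps `s`, to be tiled with one tile starting at each level `l < L`. -/
noncomputable def stair (n L : ℕ) (s : ℕ → Prop) : Finset (ℤ × ℤ) :=
  (Finset.range (L + n)).biUnion fun k =>
    (Finset.range (window n L k).card).image (stairSquare s k)

theorem level_stairSquare (s : ℕ → Prop) (k j : ℕ) : level (stairSquare s k j) = k := by
  simp [level, stairSquare]

theorem stairSquare_inj {s : ℕ → Prop} {k k' j j' : ℕ}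
    (h : stairSquare s k j = stairSquare s k' j') : k = k' ∧ j = j' := by
  have h1 := congrArg level h
  rw [level_stairSquare, level_stairSquare, Nat.cast_inj] at h1
  subst h1
  simp only [stairSquare, Prod.mk.injEq, Nat.cast_inj] at h
  exact ⟨rfl, by omega⟩

/-- The steps of the stair tiled by `L` tiles stacked in the order `ρ`. -/
def stepsOf (n L : ℕ) (ρ : ℕ → ℝ) (m : ℕ) : Prop := n ≤ m ∧ (L ≤ m ∨ ρ (m - n) < ρ m)

/-- The tile starting at level `l` in the tiling given by the order `ρ`. -/
noncomputable def stairTile (n L : ℕ) (ρ : ℕ → ℝ) (l : ℕ) : Finset (ℤ × ℤ) :=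
  (Finset.range n).image fun i =>
    stairSquare (stepsOf n L ρ) (l + i) (rank ρ (window n L (l + i)) l)

/-- The tiling of a stair given by the order `ρ`. -/
noncomputable def stairTiling (n L : ℕ) (ρ : ℕ → ℝ) : Finset (Finset (ℤ × ℤ)) :=
  (Finset.range L).image (stairTile n L ρ)

theorem rank_window_succ (n L k l : ℕ) (ρ : ℕ → ℝ) (hl : l < L) (hk : k + 1 < l + n) :
    rank ρ (window n L (k + 1)) l + (if n ≤ k + 1 ∧ ρ (k + 1 - n) < ρ l then 1 else 0) =
      rank ρ (window n L k) l + (if k + 1 < L ∧ ρ (k + 1) < ρ l then 1 else 0) := by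
  set C := (Finset.range L).filter fun m => m ≤ k + 1 ∧ k < m + n ∧ ρ m < ρ l with hC
  trans C.card
  · split_ifs with h
    · have : k + 1 - n ∉ (window n L (k + 1)).filter fun m => ρ m < ρ l := by
        simp only [Finset.mem_filter, mem_window]
        omega
      rw [rank, ← Finset.card_insert_of_notMem this]
      congr 1
      ext m
      simp only [hC, Finset.mem_insert, Finset.mem_filter, mem_window, Finset.mem_range]
      constructor
      · rintro (rfl | h1)
        · exact ⟨by omega, by omega, by omega, h.2⟩
        · exact ⟨by omega, by omega, by omega, h1.2⟩
      · rintro ⟨h1, h2, h3, h4⟩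
        by_cases h5 : m = k + 1 - n
        · exact Or.inl h5
        · exact Or.inr ⟨by omega, h4⟩
    · rw [rank, add_zero]
      congr 1
      ext m
      simp only [hC, Finset.mem_filter, mem_window, Finset.mem_range]
      constructor
      · rintro ⟨h1, h2⟩
        exact ⟨by omega, by omega, by omega, h2⟩
      · rintro ⟨h1, h2, h3, h4⟩
        refine ⟨⟨h1, h2, ?_⟩, h4⟩
        by_contra h5
        refine h ⟨by omega, ?_⟩
        rwa [show k + 1 - n = m by omega]
  · split_ifs with h
    · have : k + 1 ∉ (window n L k).filter fun m => ρ m < ρ l := by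
        simp only [Finset.mem_filter, mem_window]
        omega
      rw [rank, ← Finset.card_insert_of_notMem this]
      congr 1
      ext m
      simp only [hC, Finset.mem_insert, Finset.mem_filter, mem_window, Finset.mem_range]
      constructor
      · rintro ⟨h1, h2, h3, h4⟩
        by_cases h5 : m = k + 1
        · exact Or.inl h5
        · exact Or.inr ⟨by omega, h4⟩
      · rintro (rfl | h1)
        · exact ⟨by omega, by omega, by omega, h.2⟩
        · exact ⟨by omega, by omega, by omega, h1.2⟩
    · rw [rank, add_zero]
      congr 1
      ext m
      simp only [hC, Finset.mem_filter, mem_window, Finset.mem_range]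
      constructor
      · rintro ⟨h1, h2, h3, h4⟩
        refine ⟨⟨h1, ?_, h3⟩, h4⟩
        by_contra h5
        obtain rfl : m = k + 1 := by omega
        exact h ⟨h1, h4⟩
      · rintro ⟨h1, h2⟩
        exact ⟨by omega, by omega, by omega, h2⟩

theorem isRibbon_stairTile {n L l : ℕ} (ρ : ℕ → ℝ) (hl : l < L) :
    IsRibbon n (stairTile n L ρ l) := by
  refine ⟨_, fun i hi => ?_, rfl⟩
  have hrank := rank_window_succ n L (l + i) l ρ hl (by omega)
  have hcount : Nat.count (stepsOf n L ρ) (l + i + 1 + 1) = Nat.count (stepsOf n L ρ) (l + i + 1) +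
      if stepsOf n L ρ (l + i + 1) then 1 else 0 := Nat.count_succ _ _
  have hs : stepsOf n L ρ (l + i + 1) ↔
      n ≤ l + i + 1 ∧ (L ≤ l + i + 1 ∨ ρ (l + i + 1 - n) < ρ (l + i + 1)) := Iff.rfl
  have key : Nat.count (stepsOf n L ρ) (l + i + 1 + 1) +
        rank ρ (window n L (l + i + 1)) l = Nat.count (stepsOf n L ρ) (l + i + 1) +
        rank ρ (window n L (l + i)) l + 1 ∨
      Nat.count (stepsOf n L ρ) (l + i + 1 + 1) +
        rank ρ (window n L (l + i + 1)) l = Nat.count (stepsOf n L ρ) (l + i + 1) +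
        rank ρ (window n L (l + i)) l := by
    split_ifs at hrank hcount with h1 h2 h3 h3 h2 h3 h3
    all_goals try omega
    · rw [hs] at h3
      push Not at h3
      have h4 := h3 h1.1
      exact absurd ⟨by omega, h4.2.trans_lt h1.2⟩ h2
    · rw [hs] at h3
      refine absurd ⟨h3.1, ?_⟩ h1
      rcases h3.2 with h4 | h4
      · omega
      · exact h4.trans h2.2
  rw [← add_assoc]
  rcases key with h | h
  · left
    ext
    · simp only [stairSquare, h, Prod.fst_add]; push_cast; ring
    · simp only [stairSquare, h, Prod.snd_add]; push_cast; ring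
  · right
    ext
    · simp only [stairSquare, h, Prod.fst_add]; push_cast; ring
    · simp only [stairSquare, h, Prod.snd_add]; push_cast; ring

theorem mem_stairTile {n L l : ℕ} {ρ : ℕ → ℝ} {x : ℤ × ℤ} : x ∈ stairTile n L ρ l ↔
    ∃ k, l ≤ k ∧ k < l + n ∧ stairSquare (stepsOf n L ρ) k (rank ρ (window n L k) l) = x := by
  simp only [stairTile, Finset.mem_image, Finset.mem_range]
  constructor
  · rintro ⟨i, hi, rfl⟩
    exact ⟨l + i, by omega, by omega, rfl⟩
  · rintro ⟨k, h1, h2, rfl⟩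
    exact ⟨k - l, by omega, by rw [show l + (k - l) = k by omega]⟩

theorem injOn_window {n L k : ℕ} {ρ : ℕ → ℝ} (hρ : Set.InjOn ρ (Set.Iio L)) :
    Set.InjOn ρ (window n L k) :=
  hρ.mono fun _ hx => (mem_window.1 (Finset.mem_coe.1 hx)).1

theorem isTiling_stairTiling {n L : ℕ} {ρ : ℕ → ℝ} (hρ : Set.InjOn ρ (Set.Iio L)) :
    IsTiling n (stair n L (stepsOf n L ρ)) (stairTiling n L ρ) := by
  refine ⟨fun T hT => ?_, fun T hT T' hT' hne => ?_, ?_⟩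
  · obtain ⟨l, hl, rfl⟩ := Finset.mem_image.1 hT
    exact isRibbon_stairTile ρ (Finset.mem_range.1 hl)
  · obtain ⟨l, hl, rfl⟩ := Finset.mem_image.1 (Finset.mem_coe.1 hT)
    obtain ⟨l', hl', rfl⟩ := Finset.mem_image.1 (Finset.mem_coe.1 hT')
    refine Finset.disjoint_left.2 fun x hx hx' => hne ?_
    obtain ⟨k, h1, h2, rfl⟩ := mem_stairTile.1 hx
    obtain ⟨k', h3, h4, h5⟩ := mem_stairTile.1 hx'
    obtain ⟨rfl, h6⟩ := stairSquare_inj h5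
    rw [Finset.mem_range] at hl hl'
    rw [rank_injOn (injOn_window hρ) (mem_window.2 ⟨hl', h3, h4⟩) (mem_window.2 ⟨hl, h1, h2⟩) h6]
  · ext x
    simp only [stairTiling, stair, Finset.mem_biUnion, Finset.mem_image, Finset.mem_range, id]
    constructor
    · rintro ⟨_, ⟨l, hl, rfl⟩, hx⟩
      obtain ⟨k, h1, h2, rfl⟩ := mem_stairTile.1 hx
      exact ⟨k, by omega, _, rank_lt_card (mem_window.2 ⟨hl, h1, h2⟩), rfl⟩
    · rintro ⟨k, hk, j, hj, rfl⟩
      rw [← Finset.mem_range, ← image_rank (injOn_window hρ)] at hj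
      obtain ⟨l, hl, rfl⟩ := Finset.mem_image.1 hj
      obtain ⟨h1, h2, h3⟩ := mem_window.1 hl
      exact ⟨_, ⟨l, h1, rfl⟩, mem_stairTile.2 ⟨k, h2, h3, rfl⟩⟩

theorem eq_of_stairTile_eq {n L l l' : ℕ} (hn : 0 < n) {ρ ρ' : ℕ → ℝ}
    (h : stairTile n L ρ l = stairTile n L ρ' l') : l = l' := by
  have key : ∀ {ρ ρ' : ℕ → ℝ} {l l' : ℕ}, stairTile n L ρ l = stairTile n L ρ' l' → l' ≤ l := by
    intro ρ ρ' l l' h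
    have h1 : stairSquare (stepsOf n L ρ) l (rank ρ (window n L l) l) ∈ stairTile n L ρ l :=
      mem_stairTile.2 ⟨l, le_refl _, Nat.lt_add_of_pos_right hn, rfl⟩
    rw [h] at h1
    obtain ⟨k, h2, -, h3⟩ := mem_stairTile.1 h1
    have h4 := congrArg level h3
    rw [level_stairSquare, level_stairSquare, Nat.cast_inj] at h4
    omega
  exact le_antisymm (key h.symm) (key h)

theorem card_stair {n L : ℕ} (hn : 0 < n) {ρ : ℕ → ℝ} (hρ : Set.InjOn ρ (Set.Iio L)) :
    (stair n L (stepsOf n L ρ)).card = L * n := by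
  rw [(isTiling_stairTiling hρ).card_eq, stairTiling, Finset.card_image_of_injOn,
    Finset.card_range]
  exact fun l _ l' _ h => eq_of_stairTile_eq hn h

/-- A stair tiling determines the relative order of any two of its tiles whose levels differ by
less than `n`. -/
theorem lt_iff_lt_of_stairTiling_eq {n L : ℕ} (hn : 0 < n) {ρ ρ' : ℕ → ℝ}
    (hs : stepsOf n L ρ = stepsOf n L ρ') (h : stairTiling n L ρ = stairTiling n L ρ')
    {l m : ℕ} (hml : m ≤ l) (hlm : l < m + n) (hl : l < L) : ρ m < ρ l ↔ ρ' m < ρ' l := by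
  have htile : ∀ i < L, stairTile n L ρ i = stairTile n L ρ' i := by
    intro i hi
    have h1 : stairTile n L ρ i ∈ stairTiling n L ρ' :=
      h ▸ Finset.mem_image_of_mem _ (Finset.mem_range.2 hi)
    obtain ⟨j, -, hj⟩ := Finset.mem_image.1 h1
    rw [← hj, eq_of_stairTile_eq hn hj]
  have hrank : ∀ i ∈ window n L l, rank ρ (window n L l) i = rank ρ' (window n L l) i := by
    intro i hi
    obtain ⟨h1, h2, h3⟩ := mem_window.1 hi
    have h4 : stairSquare (stepsOf n L ρ) l (rank ρ (window n L l) i) ∈ stairTile n L ρ i :=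
      mem_stairTile.2 ⟨l, h2, h3, rfl⟩
    rw [htile i h1] at h4
    obtain ⟨k, -, -, h5⟩ := mem_stairTile.1 h4
    rw [hs] at h5
    obtain ⟨rfl, h6⟩ := stairSquare_inj h5
    exact h6.symm
  have hm : m ∈ window n L l := mem_window.2 ⟨by omega, hml, hlm⟩
  rw [← rank_lt_rank_iff hm, ← rank_lt_rank_iff hm, hrank m hm,
    hrank l (mem_window.2 ⟨hl, le_refl _, by omega⟩)]

/-- Some stair has at least `((n + 1) / 2) ^ a` tilings: the `(n + 1) ^ a` rank sequences are
distributed over `2 ^ a` stairs. -/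
theorem exists_pow_le_tilingCount {n : ℕ} (hn : 0 < n) (a : ℕ) :
    ∃ R : Finset (ℤ × ℤ), R.card = (a + n) * n ∧
      (((n : ℝ) + 1) / 2) ^ a ≤ TilingCount n R := by
  have hex : ∀ f : Fin a → Fin (n + 1), ∃ ρ : ℕ → ℝ, Set.InjOn ρ (Set.Iio (a + n)) ∧
      ∀ i : Fin a, ((Finset.Ico (i : ℕ) (i + n)).filter (fun m => ρ m < ρ (i + n))).card = f i := by
    intro f
    obtain ⟨ρ, h1, h2⟩ := exists_injOn_card_eq n
      (fun l => if h : n ≤ l ∧ l - n < a then (f ⟨l - n, h.2⟩ : ℕ) else 0) (fun l => by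
        split_ifs with h
        · have := (f ⟨l - n, h.2⟩).is_lt
          omega
        · omega) (a + n)
    refine ⟨ρ, h1, fun i => ?_⟩
    have := h2 (i + n) (by omega)
    simpa using this
  choose ρ hinj hrank using hex
  set g : (Fin a → Fin (n + 1)) → Fin a → Bool := fun f i => decide (ρ f i < ρ f (i + n)) with hg
  obtain ⟨y, -, hy⟩ := Finset.exists_le_card_fiber_of_nsmul_le_card_of_maps_to
    (s := Finset.univ) (t := Finset.univ) (f := g) (b := (((n : ℝ) + 1) / 2) ^ a)
    (fun _ _ => Finset.mem_univ _) Finset.univ_nonempty (by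
      simp only [Finset.card_univ, Fintype.card_fun, Fintype.card_fin, Fintype.card_bool,
        nsmul_eq_mul, Nat.cast_pow, Nat.cast_ofNat, Nat.cast_add, Nat.cast_one]
      rw [div_pow]
      field_simp
      exact le_refl _)
  obtain ⟨f₀, hf₀⟩ : (Finset.univ.filter fun f => g f = y).Nonempty := by
    rw [← Finset.card_pos, ← Nat.cast_pos (α := ℝ)]
    refine lt_of_lt_of_le (b := (((n : ℝ) + 1) / 2) ^ a) (by positivity) (hy.trans_eq ?_)
    congr!
  have hsteps : ∀ f, g f = y → stepsOf n (a + n) (ρ f) = stepsOf n (a + n) (ρ f₀) := by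
    intro f hf
    funext m
    refine propext (and_congr_right fun hm => ?_)
    by_cases hma : a + n ≤ m
    · simp [hma]
    · simp only [hma, false_or]
      have h1 := congrFun (hf.trans (Finset.mem_filter.1 hf₀).2.symm) ⟨m - n, by omega⟩
      simp only [hg, decide_eq_decide] at h1
      rwa [Nat.sub_add_cancel hm] at h1
  refine ⟨stair n (a + n) (stepsOf n (a + n) (ρ f₀)), card_stair hn (hinj f₀), hy.trans ?_⟩
  rw [Nat.cast_le, TilingCount, ← Set.ncard_coe_finset]
  refine Set.ncard_le_ncard_of_injOn (fun f => stairTiling n (a + n) (ρ f)) (fun f hf => ?_)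
    (fun f hf f' hf' h => ?_) (finite_setOf_isTiling n _)
  · have hf : g f = y := (Finset.mem_filter.1 hf).2
    rw [Set.mem_ofPred_eq, ← hsteps f hf]
    exact isTiling_stairTiling (hinj f)
  · have hf : g f = y := (Finset.mem_filter.1 hf).2
    have hf' : g f' = y := (Finset.mem_filter.1 hf').2
    funext i
    refine Fin.ext ?_
    rw [← hrank f i, ← hrank f' i]
    congr 1
    refine Finset.filter_congr fun m hm => ?_
    obtain ⟨h1, h2⟩ := Finset.mem_Ico.1 hm
    rcases h1.eq_or_lt with rfl | h1
    · have h3 := congrFun (hf.trans hf'.symm) i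
      simpa only [hg, decide_eq_decide] using h3
    · exact lt_iff_lt_of_stairTiling_eq hn ((hsteps f hf).trans (hsteps f' hf').symm) h
        h2.le (by omega) (by omega)

theorem maxT_le_pow {n : ℕ} (hn : 0 < n) (a : ℕ) : maxT n a ≤ n ^ a := by
  refine csSup_le' ?_
  rintro t ⟨R, hR, rfl⟩
  exact tilingCount_le_pow hn hR

theorem tilingCount_le_maxT {n a : ℕ} (hn : 0 < n) {R : Finset (ℤ × ℤ)} (hR : R.card = a * n) :
    TilingCount n R ≤ maxT n a := by
  refine le_csSup ⟨n ^ a, ?_⟩ ⟨R, hR, rfl⟩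
  rintro t ⟨R, hR, rfl⟩
  exact tilingCount_le_pow hn hR

theorem logb_maxT_div_le {n : ℕ} (hn : 0 < n) (a : ℕ) :
    Real.logb 2 (maxT n a) / a ≤ Real.logb 2 n := by
  have hlog : 0 ≤ Real.logb 2 n :=
    Real.logb_nonneg one_lt_two (by exact_mod_cast hn)
  rcases (maxT n a).eq_zero_or_pos with h | h
  · simpa [h] using hlog
  refine div_le_of_le_mul₀ a.cast_nonneg hlog ?_
  rw [mul_comm, ← Real.logb_pow]
  exact Real.logb_le_logb_of_le one_lt_two (by exact_mod_cast h)
    (by exact_mod_cast maxT_le_pow hn a)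

theorem mul_logb_le_logb_maxT {n : ℕ} (hn : 0 < n) (a : ℕ) :
    a * Real.logb 2 (((n : ℝ) + 1) / 2) ≤ Real.logb 2 (maxT n (a + n)) := by
  obtain ⟨R, hR, h⟩ := exists_pow_le_tilingCount hn a
  rw [← Real.logb_pow]
  exact Real.logb_le_logb_of_le one_lt_two (by positivity)
    (h.trans (by exact_mod_cast tilingCount_le_maxT hn hR))

theorem logb_le_of_tendsto_logb_maxT {n : ℕ} (hn : 0 < n) {τ : ℝ}
    (hτ : Filter.Tendsto (fun a : ℕ => Real.logb 2 (maxT n a) / a) Filter.atTop (nhds τ)) :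
    Real.logb 2 (((n : ℝ) + 1) / 2) ≤ τ := by
  have h1 := (tendsto_natCast_div_add_atTop (n : ℝ)).mul_const (Real.logb 2 (((n : ℝ) + 1) / 2))
  rw [one_mul] at h1
  refine le_of_tendsto_of_tendsto' h1 (hτ.comp (Filter.tendsto_add_atTop_nat n)) fun a => ?_
  simp only [Function.comp_apply, Nat.cast_add]
  rw [div_mul_eq_mul_div]
  exact div_le_div_of_nonneg_right (mul_logb_le_logb_maxT hn a) (by positivity)

theorem ceil_half_le (n : ℕ) : ((⌈(n : ℝ) / 2⌉ : ℤ) : ℝ) ≤ ((n : ℝ) + 1) / 2 := by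
  have h : ⌈(n : ℝ) / 2⌉ ≤ ((n : ℤ) + 1) / 2 := by
    rw [Int.ceil_le, div_le_iff₀ two_pos]
    have : (n : ℤ) ≤ ((n : ℤ) + 1) / 2 * 2 := by omega
    exact_mod_cast this
  have h' : ⌈(n : ℝ) / 2⌉ * 2 ≤ (n : ℤ) + 1 := by omega
  rw [le_div_iff₀ two_pos]
  exact_mod_cast h'

theorem tau_n_bounds (n : ℕ) (hn : 2 ≤ n) (τn : ℝ)
    (hτ : Filter.Tendsto (fun a : ℕ => Real.logb 2 (maxT n a) / a)
      Filter.atTop (nhds τn)) :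
    Real.logb 2 n - 1 ≤ τn ∧ τn ≤ Real.logb 2 n ∧
    Real.logb 2 ((⌈(n : ℝ) / 2⌉ : ℤ) : ℝ) ≤ τn ∧
    Real.logb 2 n - 1 ≤ Real.logb 2 ((⌈(n : ℝ) / 2⌉ : ℤ) : ℝ) := by
  have hn0 : (0 : ℝ) < n := by exact_mod_cast two_pos.trans_le hn
  have hceil : (0 : ℝ) < (⌈(n : ℝ) / 2⌉ : ℤ) := (half_pos hn0).trans_le (Int.le_ceil _)
  have hsub : Real.logb 2 n - 1 ≤ Real.logb 2 ((⌈(n : ℝ) / 2⌉ : ℤ) : ℝ) := by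
    rw [← Real.logb_self_eq_one one_lt_two, ← Real.logb_div hn0.ne' two_ne_zero]
    exact Real.logb_le_logb_of_le one_lt_two (half_pos hn0) (Int.le_ceil _)
  have hle : Real.logb 2 ((⌈(n : ℝ) / 2⌉ : ℤ) : ℝ) ≤ τn :=
    (Real.logb_le_logb_of_le one_lt_two hceil (ceil_half_le n)).trans
      (logb_le_of_tendsto_logb_maxT (by omega) hτ)
  exact ⟨hsub.trans hle, le_of_tendsto' hτ (logb_maxT_div_le (by omega)), hle, hsub⟩
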